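/- Let n ≥ 1 be an integer and let V : ℝⁿ → ℝ be differentiable and nowhere zero, θ : ℝⁿ → ℝⁿ differentiable, and g : ℝⁿ → (invertible symmetric n×n real matrices) differentiable. For each x let G(x) be the stationary metric matrix built from V(x), θ(x), g(x), with inverse H(x), and define the Christoffel symbols of the time-independent metric by Γ^λ_{μν} = (1/2) Σ_ρ H^{λρ} (∂_μ G_{ρν} + ∂_ν G_{ρμ} − ∂_ρ G_{μν}), where the derivative ∂₀ in the time direction of every component is zero and ∂ᵢ (1 ≤ i ≤ n) are the partial derivatives on ℝⁿ. Then at every point, Γ^k_{00} = V Σ_l g^{kl} ∂_l V for 1 ≤ k ≤ n, and Γ⁰_{00} = −V Σ_{i,l} g^{il} θ_l ∂_i V, where g^{kl} are the entries of g⁻¹; that is, Γ^k_{00} = V D^k V and Γ⁰_{00} = −θ^i V D_i V. -/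

import Mathlib

open Matrix

/-- The stationary metric matrix `G` of the spacetime metric
`𝐠 = −V²(dt + θᵢdxⁱ)² + gᵢⱼdxⁱdxʲ`. -/
def statMetric (n : ℕ) (V : ℝ) (θ : Fin n → ℝ) (g : Matrix (Fin n) (Fin n) ℝ) :
    Matrix (Unit ⊕ Fin n) (Unit ⊕ Fin n) ℝ :=
  Matrix.fromBlocks
    (Matrix.of fun _ _ => -V ^ 2)
    (Matrix.of fun _ j => -V ^ 2 * θ j)
    (Matrix.of fun i _ => -V ^ 2 * θ i)
    (Matrix.of fun i j => g i j - V ^ 2 * θ i * θ j)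

/-- The spacetime partial derivative of a time-independent function: the derivative in
the time direction (`Sum.inl`) vanishes, and in the spatial direction `Sum.inr i` it is
the partial derivative `∂ᵢ` on ℝⁿ. -/
noncomputable def stD (n : ℕ) (φ : (Fin n → ℝ) → ℝ) :
    Unit ⊕ Fin n → (Fin n → ℝ) → ℝ
  | Sum.inl _ => fun _ => 0
  | Sum.inr i => fun x => fderiv ℝ φ x (Pi.single i 1)

/-- The inverse of the stationary metric matrix, in block form. -/
theorem statMetric_inv (n : ℕ) (V : ℝ) (θ : Fin n → ℝ) (g : Matrix (Fin n) (Fin n) ℝ)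
    (hV : V ≠ 0) (hg : IsUnit g) :
    (statMetric n V θ g)⁻¹ = Matrix.fromBlocks
      (Matrix.of fun _ _ => -(V ^ 2)⁻¹ + θ ⬝ᵥ (g⁻¹ *ᵥ θ))
      (Matrix.of fun _ j => -(θ ᵥ* g⁻¹) j)
      (Matrix.of fun i _ => -(g⁻¹ *ᵥ θ) i)
      g⁻¹ := by
  have hmul : g * g⁻¹ = 1 := Matrix.mul_nonsing_inv g ((Matrix.isUnit_iff_isUnit_det g).mp hg)
  have hvec (i : Fin n) : ∑ k, g i k * (g⁻¹ *ᵥ θ) k = θ i := by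
    have h : g *ᵥ (g⁻¹ *ᵥ θ) = θ := by rw [Matrix.mulVec_mulVec, hmul, Matrix.one_mulVec]
    exact congrFun h i
  have hent (i j : Fin n) : ∑ k, g i k * g⁻¹ k j = (1 : Matrix (Fin n) (Fin n) ℝ) i j :=
    congrFun (congrFun hmul i) j
  have hV2 : V ^ 2 * (V ^ 2)⁻¹ = 1 := mul_inv_cancel₀ (pow_ne_zero 2 hV)
  apply Matrix.inv_eq_right_inv
  rw [statMetric, Matrix.fromBlocks_multiply, ← Matrix.fromBlocks_one]
  congr 1 <;> ext i j <;>
    simp only [Matrix.add_apply, Matrix.mul_apply, Matrix.of_apply, Finset.univ_unique,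
      Finset.sum_singleton, sub_mul, Finset.sum_sub_distrib, mul_neg, Finset.sum_neg_distrib,
      mul_assoc, ← Finset.mul_sum, hvec, hent]
  · simp only [dotProduct, Matrix.one_apply, Subsingleton.elim i j, if_true]
    linear_combination hV2
  · simp only [Matrix.vecMul, dotProduct, Matrix.zero_apply]
    ring
  · simp only [dotProduct, Matrix.zero_apply]
    linear_combination θ i * hV2
  · simp only [Matrix.vecMul, dotProduct]
    ring

/-- The spatial derivatives of `G₀₀ = -V²`. -/
theorem fderiv_statMetric_time (n : ℕ) {V : (Fin n → ℝ) → ℝ} (θ : (Fin n → ℝ) → Fin n → ℝ)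
    (g : (Fin n → ℝ) → Matrix (Fin n) (Fin n) ℝ) {x : Fin n → ℝ}
    (hV : DifferentiableAt ℝ V x) (v : Fin n → ℝ) :
    fderiv ℝ (fun y => statMetric n (V y) (θ y) (g y) (Sum.inl ()) (Sum.inl ())) x v =
      -(2 * V x * fderiv ℝ V x v) := by
  have h : HasFDerivAt
      (fun y => statMetric n (V y) (θ y) (g y) (Sum.inl ()) (Sum.inl ())) _ x :=
    (hV.hasFDerivAt.pow 2).neg
  rw [h.fderiv]
  simp

/-- For the stationary metric G(x) built from differentiable fields V
(nowhere zero), θ and g (invertible symmetric), with inverse H(x) and Christoffel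
symbols Γ^λ_{μν} = (1/2) Σ_ρ H^{λρ}(∂_μ G_{ρν} + ∂_ν G_{ρμ} − ∂_ρ G_{μν}) (with ∂₀ = 0),
one has Γ^k_{00} = V D^k V = V Σ_l g^{kl} ∂_l V and
Γ⁰_{00} = −θ^i V D_i V = −V Σ_{i,l} g^{il} θ_l ∂_i V at every point. -/
theorem christoffel_00 (n : ℕ) (hn : 1 ≤ n)
    (V : (Fin n → ℝ) → ℝ) (θ : (Fin n → ℝ) → Fin n → ℝ)
    (g : (Fin n → ℝ) → Matrix (Fin n) (Fin n) ℝ)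
    (hV : Differentiable ℝ V) (hVne : ∀ x, V x ≠ 0)
    (hθ : ∀ i, Differentiable ℝ fun x => θ x i)
    (hgd : ∀ i j, Differentiable ℝ fun x => g x i j)
    (hgs : ∀ x, (g x).IsSymm) (hgu : ∀ x, IsUnit (g x)) :
    let G : (Fin n → ℝ) → Matrix (Unit ⊕ Fin n) (Unit ⊕ Fin n) ℝ :=
      fun x => statMetric n (V x) (θ x) (g x)
    let H : (Fin n → ℝ) → Matrix (Unit ⊕ Fin n) (Unit ⊕ Fin n) ℝ := fun x => (G x)⁻¹
    let Γ : (Unit ⊕ Fin n) → (Unit ⊕ Fin n) → (Unit ⊕ Fin n) → (Fin n → ℝ) → ℝ :=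
      fun lam μ ν x => (1 / 2) * ∑ ρ, H x lam ρ *
        (stD n (fun y => G y ρ ν) μ x + stD n (fun y => G y ρ μ) ν x
          - stD n (fun y => G y μ ν) ρ x)
    ∀ x : Fin n → ℝ,
      (∀ k : Fin n,
        Γ (Sum.inr k) (Sum.inl ()) (Sum.inl ()) x =
          V x * ∑ l, (g x)⁻¹ k l * fderiv ℝ V x (Pi.single l 1)) ∧
      Γ (Sum.inl ()) (Sum.inl ()) (Sum.inl ()) x =
        -(V x * ∑ i, ∑ l, (g x)⁻¹ i l * θ x l * fderiv ℝ V x (Pi.single i 1)) := by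
  intro G H Γ x
  have hΓ (lam : Unit ⊕ Fin n) : Γ lam (Sum.inl ()) (Sum.inl ()) x =
      V x * ∑ i, H x lam (Sum.inr i) * fderiv ℝ V x (Pi.single i 1) := by
    simp only [Γ, G, Fintype.sum_sum_type, stD, fderiv_statMetric_time n θ g (hV x),
      add_zero, sub_zero, zero_sub, mul_zero, Finset.sum_const_zero, zero_add, Finset.mul_sum]
    exact Finset.sum_congr rfl fun i _ => by ring
  have hH := statMetric_inv n (V x) (θ x) (g x) (hVne x) (hgu x)
  refine ⟨fun k => ?_, ?_⟩
  · simp only [hΓ, H, G, hH, Matrix.fromBlocks_apply₂₂]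
  · have hsymm (i l : Fin n) : (g x)⁻¹ l i = (g x)⁻¹ i l := by
      have h := Matrix.transpose_nonsing_inv (g x)
      rw [(hgs x).eq] at h
      exact congrFun (congrFun h i) l
    simp only [hΓ, H, G, hH, Matrix.fromBlocks_apply₁₂, Matrix.of_apply, Matrix.vecMul,
      dotProduct, hsymm, neg_mul, Finset.sum_neg_distrib, mul_neg, Finset.sum_mul,
      mul_comm (θ x _)]
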